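/- Let n and k be positive integers with k dividing n(n+1)/2, let p_1 ≤ … ≤ p_k be positive integers with p_1+…+p_k = n, and let A be a minimal partition of [n] implementing (p_1,…,p_k). Suppose A contains distinct sets X, Z, Y such that S(X) = s^{n,k} − 1, Z is exact, Y is high, and there are elements a ∈ X with a+1 ∈ Z, and b ∈ Z with b+1 ∈ Y. Then b = a+1. -/

import Mathlib

open Finset

/-- `s^{n,k} = (n(n+1)/2)/k`. -/
def magicConst (n k : ℕ) : ℕ := (n * (n + 1) / 2) / k

/-- `A` is a partition of `[n] = {1,…,n}` into `k` (indexed) parts. -/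
def IsPartitionOn (n : ℕ) {k : ℕ} (A : Fin k → Finset ℕ) : Prop :=
  (∀ i j : Fin k, i ≠ j → Disjoint (A i) (A j)) ∧
    Finset.univ.biUnion A = Finset.Icc 1 n

/-- The partition `A` of `[n]` implements the sequence of sizes `p` (up to reindexing). -/
def Implements (n : ℕ) {k : ℕ} (A : Fin k → Finset ℕ) (p : Fin k → ℕ) : Prop :=
  IsPartitionOn n A ∧ ∃ e : Equiv.Perm (Fin k), ∀ i, (A (e i)).card = p i

/-- Every part of the partition has sum `s^{n,k}`. -/
def Equitable (n : ℕ) {k : ℕ} (A : Fin k → Finset ℕ) : Prop :=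
  ∀ i, (A i).sum id = magicConst n k

/-- `d(A) = Σ_i (S(A_i) − s^{n,k})²`. -/
def dVal (n : ℕ) {k : ℕ} (A : Fin k → Finset ℕ) : ℤ :=
  ∑ i : Fin k, ((((A i).sum id : ℕ) : ℤ) - (magicConst n k : ℤ)) ^ 2

/-- A partition implementing `p` minimizing `d` among all partitions implementing `p`. -/
def MinimalPartition (n : ℕ) {k : ℕ} (A : Fin k → Finset ℕ) (p : Fin k → ℕ) : Prop :=
  Implements n A p ∧ ∀ B : Fin k → Finset ℕ, Implements n B p → dVal n A ≤ dVal n B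

/-- Condition (★): `Σ_{i=1}^{P_j} (n−i+1) ≥ j·s^{n,k}` for all `j = 1,…,k`,
where `P_j = p_1 + ⋯ + p_j`. -/
def StarCond (n k : ℕ) (p : Fin k → ℕ) : Prop :=
  ∀ j : Fin k,
    ((j : ℕ) + 1) * magicConst n k ≤ ∑ i ∈ Finset.range (∑ t ∈ Finset.Iic j, p t), (n - i)

/-- The width `ω(A)` of a partition: the minimum of `y − x` over pairs `x < y` with `x`
in a low set and `y` in a high set (`⊤` if there is no such pair). -/
noncomputable def width (n : ℕ) {k : ℕ} (A : Fin k → Finset ℕ) : ℕ∞ :=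
  sInf { w : ℕ∞ | ∃ (x y : ℕ) (i j : Fin k), x ∈ A i ∧ y ∈ A j ∧ x < y ∧
    (A i).sum id < magicConst n k ∧ magicConst n k < (A j).sum id ∧ w = (y - x : ℕ) }

/-- The image of a partition of `[n]` under a permutation preserving `[n]` is a partition. -/
lemma isPartitionOn_map {n k : ℕ} {A : Fin k → Finset ℕ} (hA : IsPartitionOn n A)
    (σ : Equiv.Perm ℕ) (hσ : ∀ x ∈ Finset.Icc 1 n, σ x ∈ Finset.Icc 1 n) :
    IsPartitionOn n fun i => (A i).map σ.toEmbedding := by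
  refine ⟨fun i j hij => (Finset.disjoint_map _).mpr (hA.1 i j hij), ?_⟩
  refine Finset.eq_of_subset_of_card_le (fun y hy => ?_) ?_
  · simp only [Finset.mem_biUnion, Finset.mem_map_equiv, Finset.mem_univ, true_and] at hy
    obtain ⟨i, hi⟩ := hy
    have hx : σ.symm y ∈ Finset.Icc 1 n :=
      hA.2 ▸ Finset.mem_biUnion.mpr ⟨i, Finset.mem_univ i, hi⟩
    simpa using hσ _ hx
  · rw [← hA.2, Finset.card_biUnion fun i _ j _ hij => hA.1 i j hij,
      Finset.card_biUnion fun i _ j _ hij => (Finset.disjoint_map _).mpr (hA.1 i j hij)]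
    simp

/-- The effect on the sum of a set of two disjoint transpositions of consecutive integers. -/
lemma sum_map_swap_mul_swap (s : Finset ℕ) {a b : ℕ} (hab : b ≠ a) (hba : b + 1 ≠ a)
    (hne : b ≠ a + 1) :
    (((s.map (Equiv.swap a (a + 1) * Equiv.swap b (b + 1)).toEmbedding).sum id : ℕ) : ℤ) =
      (s.sum id : ℕ) + (if a ∈ s then 1 else 0) - (if a + 1 ∈ s then 1 else 0) +
        (if b ∈ s then 1 else 0) - (if b + 1 ∈ s then 1 else 0) := by
  have hpt : ∀ x : ℕ, (((Equiv.swap a (a + 1) * Equiv.swap b (b + 1)) x : ℕ) : ℤ) =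
      x + (if x = a then 1 else 0) - (if x = a + 1 then 1 else 0) +
        (if x = b then 1 else 0) - (if x = b + 1 then 1 else 0) := by
    intro x
    simp only [Equiv.Perm.mul_apply, Equiv.swap_apply_def]
    split_ifs <;> omega
  rw [Finset.sum_map]
  push_cast
  simp only [Equiv.coe_toEmbedding, id, hpt, Finset.sum_add_distrib, Finset.sum_sub_distrib,
    Finset.sum_ite_eq']

/-- Lemma 3(a). -/
theorem stmt_19 (n k : ℕ) (hn : 0 < n) (hk : 0 < k) (hdvd : k ∣ n * (n + 1) / 2)
    (p : Fin k → ℕ) (hp : ∀ i, 0 < p i) (hmono : Monotone p)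
    (hsum : ∑ i : Fin k, p i = n)
    (A : Fin k → Finset ℕ) (hA : MinimalPartition n A p)
    (ix iz iy : Fin k) (hxz : ix ≠ iz) (hxy : ix ≠ iy) (hzy : iz ≠ iy)
    (hX : (A ix).sum id + 1 = magicConst n k)
    (hZ : (A iz).sum id = magicConst n k)
    (hY : magicConst n k < (A iy).sum id)
    (a b : ℕ) (ha : a ∈ A ix) (ha1 : a + 1 ∈ A iz)
    (hb : b ∈ A iz) (hb1 : b + 1 ∈ A iy) :
    b = a + 1 := by
  by_contra hne
  obtain ⟨⟨hpart, hcard⟩, hmin⟩ := hA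
  have owner : ∀ {x : ℕ} {j : Fin k}, x ∈ A j → ∀ i, x ∈ A i ↔ i = j := fun hx i =>
    ⟨fun hxi => by_contra fun h => Finset.disjoint_left.mp (hpart.1 i _ h) hxi hx,
      fun h => h ▸ hx⟩
  have hab : b ≠ a := fun h => hxz ((owner hb ix).mp (h ▸ ha))
  have hba : b + 1 ≠ a := fun h => hxy ((owner hb1 ix).mp (h ▸ ha))
  have mem_Icc : ∀ {x : ℕ} {j : Fin k}, x ∈ A j → x ∈ Finset.Icc 1 n := fun {x j} hx =>
    hpart.2 ▸ Finset.mem_biUnion.mpr ⟨j, Finset.mem_univ j, hx⟩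
  set σ : Equiv.Perm ℕ := Equiv.swap a (a + 1) * Equiv.swap b (b + 1) with hσ
  have hσ_maps : ∀ x ∈ Finset.Icc 1 n, σ x ∈ Finset.Icc 1 n := by
    intro x hx
    have h1 := mem_Icc ha
    have h2 := mem_Icc ha1
    have h3 := mem_Icc hb
    have h4 := mem_Icc hb1
    simp only [hσ, Equiv.Perm.mul_apply, Equiv.swap_apply_def]
    split_ifs <;> assumption
  let B : Fin k → Finset ℕ := fun i => (A i).map σ.toEmbedding
  have hB : Implements n B p := by
    refine ⟨isPartitionOn_map hpart σ hσ_maps, ?_⟩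
    simpa [B] using hcard
  have hsumB : ∀ i, (((B i).sum id : ℕ) : ℤ) =
      ((A i).sum id : ℕ) + (if i = ix then 1 else 0) - (if i = iy then 1 else 0) := by
    intro i
    have h := sum_map_swap_mul_swap (A i) hab hba hne
    simp only [owner ha, owner ha1, owner hb, owner hb1] at h
    linarith
  have hlt : dVal n B < dVal n A := by
    unfold dVal
    simp only [hsumB]
    have hX' : (((A ix).sum id : ℕ) : ℤ) + 1 = magicConst n k := by exact_mod_cast hX
    have hY' : (magicConst n k : ℤ) < ((A iy).sum id : ℕ) := by exact_mod_cast hY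
    refine Finset.sum_lt_sum (fun i _ => ?_) ⟨ix, Finset.mem_univ ix, ?_⟩
    · by_cases h1 : i = ix
      · subst h1
        simp only [if_true, if_neg hxy]
        nlinarith
      · by_cases h2 : i = iy
        · subst h2
          simp only [if_true, if_neg h1]
          nlinarith
        · simp [h1, h2]
    · simp only [if_true, if_neg hxy]
      nlinarith
  exact (hmin B hB).not_gt hlt
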